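/- arXiv:math/0601247 — 2 statements merged into one kernel-verified Lean document; each statement's English description precedes it below -/
import Mathlib

section
/- Assume (A3). Let L ∈ ⟨p,K⟩ and let P₀, Q, R be circles tangent to L at pairwise distinct points. If Q ∩ P₀ ≠ ∅ and Q ∩ R ≠ ∅, then P₀ ∩ R ≠ ∅. -/
/-- A Laguerre plane: points, circles, and a parallelity relation. -/
structure LaguerrePlane (P : Type*) where
  Circles : Set (Set P)
  Par : P → P → Prop
  par_equiv : Equivalence Par
  joinCircle : ∀ a b c : P, ¬ Par a b → ¬ Par b c → ¬ Par a c →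
    ∃! C, C ∈ Circles ∧ a ∈ C ∧ b ∈ C ∧ c ∈ C
  touching : ∀ K ∈ Circles, ∀ p ∈ K, ∀ q, q ∉ K → ¬ Par p q →
    ∃! C, C ∈ Circles ∧ q ∈ C ∧ K ∩ C = {p}
  parPoint : ∀ (x : P), ∀ K ∈ Circles, ∃! q, Par x q ∧ q ∈ K
  nontriv : ∃ C ∈ Circles,
    (∃ a b c : P, a ∈ C ∧ b ∈ C ∧ c ∈ C ∧ a ≠ b ∧ b ≠ c ∧ a ≠ c) ∧ C ≠ Set.univ

namespace LaguerrePlane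

variable {P : Type*}

/-- The generator (parallel class) of a point. -/
def gen (L : LaguerrePlane P) (p : P) : Set P := {q | L.Par p q}

/-- The pencil ⟨p,K⟩: the circle K together with all circles tangent to K at p. -/
def pencil (L : LaguerrePlane P) (p : P) (K : Set P) : Set (Set P) :=
  insert K {M | M ∈ L.Circles ∧ M ∩ K = {p}}

/-- An automorphism of a Laguerre plane: a bijection of the points mapping
circles onto circles and preserving parallelity. -/
def IsAut (L : LaguerrePlane P) (σ : Equiv.Perm P) : Prop :=
  (∀ C, C ∈ L.Circles ↔ ⇑σ '' C ∈ L.Circles) ∧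
  (∀ x y, L.Par x y ↔ L.Par (σ x) (σ y))

/-- The line x ⊔ y of the residual plane SA(p,K):
{x} together with the orbit of y under the stabilizer of x in Δ. -/
def line (Δ : Subgroup (Equiv.Perm P)) (x y : P) : Set P :=
  {x} ∪ {z | ∃ σ ∈ Δ, σ x = x ∧ σ y = z}

/-- Parallelity of lines of the residual plane SA(p,K). -/
def LinePar (Δ : Subgroup (Equiv.Perm P)) (A B : Set P) : Prop :=
  ∃ σ ∈ Δ, ⇑σ '' A = B

end LaguerrePlane

namespace LaguerrePlane

variable {P : Type*} {L : LaguerrePlane P} {p : P} {K C D M N R : Set P} {a b c d u x y : P}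
  {Δ : Subgroup (Equiv.Perm P)} {σ : Equiv.Perm P}

lemma eq_of_par (hC : C ∈ L.Circles) (hx : x ∈ C) (hy : y ∈ C) (h : L.Par x y) : x = y :=
  (L.parPoint x C hC).unique ⟨L.par_equiv.refl x, hx⟩ ⟨h, hy⟩

lemma exists_par_mem (hC : C ∈ L.Circles) (x : P) : ∃ y ∈ C, L.Par x y := by
  obtain ⟨y, ⟨h, hy⟩, -⟩ := L.parPoint x C hC
  exact ⟨y, hy, h⟩

lemma eq_of_three_mem (hC : C ∈ L.Circles) (hD : D ∈ L.Circles)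
    (hab : a ≠ b) (hbc : b ≠ c) (hac : a ≠ c) (haC : a ∈ C) (hbC : b ∈ C) (hcC : c ∈ C)
    (haD : a ∈ D) (hbD : b ∈ D) (hcD : c ∈ D) : C = D :=
  (L.joinCircle a b c (fun h => hab (eq_of_par hC haC hbC h))
    (fun h => hbc (eq_of_par hC hbC hcC h))
    (fun h => hac (eq_of_par hC haC hcC h))).unique ⟨hC, haC, hbC, hcC⟩ ⟨hD, haD, hbD, hcD⟩

lemma eq_of_tangent (hC : C ∈ L.Circles) (hM : M ∈ L.Circles) (hN : N ∈ L.Circles)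
    (hMC : M ∩ C = {a}) (hNC : N ∩ C = {a}) (hx : x ∉ C) (hxM : x ∈ M) (hxN : x ∈ N) :
    M = N := by
  have haM : a ∈ M ∩ C := hMC ▸ rfl
  exact (L.touching C hC a haM.2 x hx
    (fun h => hx (eq_of_par hM haM.1 hxM h ▸ haM.2))).unique
    ⟨hM, hxM, Set.inter_comm M C ▸ hMC⟩ ⟨hN, hxN, Set.inter_comm N C ▸ hNC⟩

lemma circle_of_mem_pencil (hK : K ∈ L.Circles) (hC : C ∈ L.pencil p K) : C ∈ L.Circles := by
  rcases hC with rfl | h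
  exacts [hK, h.1]

lemma mem_of_mem_pencil (hp : p ∈ K) (hC : C ∈ L.pencil p K) : p ∈ C := by
  rcases hC with rfl | ⟨-, h⟩
  · exact hp
  · exact (h.symm ▸ rfl : p ∈ C ∩ K).1

lemma eq_of_mem_pencil (hK : K ∈ L.Circles) (hC : C ∈ L.pencil p K)
    (hD : D ∈ L.pencil p K) (hx : x ≠ p) (hxC : x ∈ C) (hxD : x ∈ D) : C = D := by
  rcases hC with rfl | ⟨hC, hCK⟩ <;> rcases hD with rfl | ⟨hD, hDK⟩
  · rfl
  · exact absurd (hDK.subset ⟨hxD, hxC⟩) hx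
  · exact absurd (hCK.subset ⟨hxC, hxD⟩) hx
  · exact eq_of_tangent hK hC hD hCK hDK (fun h => hx (hCK.subset ⟨hxC, h⟩)) hxC hxD

/-- `Δ` acts on the residual plane of the pencil `⟨p, K⟩` in the sense of (A1) and (A2), and
(A3) holds. -/
structure PencilAction (L : LaguerrePlane P) (p : P) (K : Set P)
    (Δ : Subgroup (Equiv.Perm P)) : Prop where
  circle : K ∈ L.Circles
  mem : p ∈ K
  isAut : ∀ σ ∈ Δ, L.IsAut σ
  fix : ∀ σ ∈ Δ, ∀ q, L.Par p q → σ q = q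
  map_pencil : ∀ σ ∈ Δ, ∀ M ∈ L.pencil p K, ⇑σ '' M ∈ L.pencil p K
  transitive : ∀ x y : P, ¬ L.Par p x → ¬ L.Par p y → ∃ σ ∈ Δ, σ x = y
  transitive_stabilizer : ∀ r ∈ K, r ≠ p → ∀ x ∈ K, x ≠ p → x ≠ r → ∀ y ∈ K, y ≠ p → y ≠ r →
    ∃ σ ∈ Δ, σ r = r ∧ σ x = y
  tangent : ∀ M ∈ L.Circles, p ∉ M → ∃! N, N ∈ L.pencil p K ∧ ∃ z, M ∩ N = {z}

namespace PencilAction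

lemma image_eq (h : PencilAction L p K Δ) (hC : C ∈ L.pencil p K) (hD : D ∈ L.pencil p K)
    (hσ : σ ∈ Δ) (hx : x ∈ C) (hσx : σ x ∈ D) (hp : σ x ≠ p) : σ '' C = D :=
  eq_of_mem_pencil h.circle (h.map_pencil σ hσ C hC) hD hp (Set.mem_image_of_mem σ hx) hσx

lemma not_par (h : PencilAction L p K Δ) (hC : C ∈ L.pencil p K) (hx : x ∈ C) (hp : x ≠ p) :
    ¬ L.Par p x := fun hpar =>
  hp (eq_of_par (circle_of_mem_pencil h.circle hC) (mem_of_mem_pencil h.mem hC) hx hpar).symm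

lemma notMem_of_tangent (h : PencilAction L p K Δ) (hC : C ∈ L.pencil p K)
    (hMC : M ∩ C = {a}) (ha : a ≠ p) : p ∉ M := fun hp =>
  ha (hMC.subset ⟨hp, mem_of_mem_pencil h.mem hC⟩ : p = a).symm

lemma image_tangent_eq (h : PencilAction L p K Δ) (hC : C ∈ L.pencil p K)
    (hM : M ∈ L.Circles) (hN : N ∈ L.Circles) (hMC : M ∩ C = {a}) (hNC : N ∩ C = {b})
    (hb : b ≠ p) (hu : L.Par p u) (huM : u ∈ M) (huN : u ∈ N)
    (hσ : σ ∈ Δ) (hab : σ a = b) : σ '' M = N := by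
  have haC : a ∈ M ∩ C := hMC ▸ rfl
  have hbC : b ∈ N ∩ C := hNC ▸ rfl
  have hσC : σ '' C = C := h.image_eq hC hC hσ haC.2 (hab ▸ hbC.2) (hab ▸ hb)
  have hσM : σ '' M ∩ C = {b} := by
    rw [← hσC, ← Set.image_inter σ.injective, hMC, Set.image_singleton, hab]
  have huC : u ∉ C := fun hu' => by
    have hup : u = p := by
      by_contra hne
      exact h.not_par hC hu' hne hu
    exact h.notMem_of_tangent hC hNC hb (hup ▸ huN)
  exact eq_of_tangent (circle_of_mem_pencil h.circle hC) (((h.isAut σ hσ).1 M).1 hM) hN hσM hNC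
    huC ⟨u, huM, h.fix σ hσ u hu⟩ huN

lemma image_tangent_self (h : PencilAction L p K Δ) (hC : C ∈ L.pencil p K)
    (hM : M ∈ L.Circles) (hMC : M ∩ C = {a}) (ha : a ≠ p) (hσ : σ ∈ Δ) (hσa : σ a = a) :
    σ '' M = M := by
  obtain ⟨u, huM, hu⟩ := exists_par_mem hM p
  exact h.image_tangent_eq hC hM hM hMC hMC ha hu huM huM hσ hσa

lemma exists_stabilizer (h : PencilAction L p K Δ) (hC : C ∈ L.pencil p K)
    (ha : a ∈ C) (hap : a ≠ p) (hx : x ∈ C) (hxp : x ≠ p) (hxa : x ≠ a)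
    (hy : y ∈ C) (hyp : y ≠ p) (hya : y ≠ a) : ∃ σ ∈ Δ, σ a = a ∧ σ x = y := by
  obtain ⟨r, hr, har⟩ := exists_par_mem h.circle a
  have hpr : ¬ L.Par p r := fun hpar =>
    h.not_par hC ha hap (L.par_equiv.trans hpar (L.par_equiv.symm har))
  have hrp : r ≠ p := fun hrp => hpr (hrp ▸ L.par_equiv.refl p)
  obtain ⟨τ, hτ, rfl⟩ := h.transitive a r (h.not_par hC ha hap) hpr
  have hτC : τ '' C = K := h.image_eq hC (Set.mem_insert _ _) hτ ha hr hrp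
  have hmem : ∀ z ∈ C, τ z ∈ K := fun z hz => hτC ▸ Set.mem_image_of_mem τ hz
  have hne : ∀ z, z ≠ p → τ z ≠ p := fun z hz hz' =>
    hz (τ.injective (hz'.trans (h.fix τ hτ p (L.par_equiv.refl p)).symm))
  obtain ⟨σ, hσ, h1, h2⟩ := h.transitive_stabilizer (τ a) hr hrp (τ x) (hmem x hx) (hne x hxp)
    (τ.injective.ne hxa) (τ y) (hmem y hy) (hne y hyp) (τ.injective.ne hya)
  refine ⟨τ⁻¹ * σ * τ, Δ.mul_mem (Δ.mul_mem (Δ.inv_mem hτ) hσ) hτ, ?_, ?_⟩ <;> simp [h1, h2]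

lemma exists_stabilizer_tangent (h : PencilAction L p K Δ) (hC : C ∈ L.pencil p K)
    (hM : M ∈ L.Circles) (hMC : M ∩ C = {a}) (ha : a ≠ p)
    (hx : x ∈ M) (hxp : ¬ L.Par p x) (hxa : x ≠ a)
    (hy : y ∈ M) (hyp : ¬ L.Par p y) (hya : y ≠ a) :
    ∃ σ ∈ Δ, σ a = a ∧ σ x = y ∧ σ '' M = M := by
  have haC : a ∈ M ∩ C := hMC ▸ rfl
  have hproj : ∀ z ∈ M, ¬ L.Par p z → z ≠ a → ∃ t ∈ C, L.Par z t ∧ t ≠ p ∧ t ≠ a := by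
    intro z hz hzp hza
    obtain ⟨t, ht, hzt⟩ := exists_par_mem (circle_of_mem_pencil h.circle hC) z
    refine ⟨t, ht, hzt, ?_, ?_⟩
    · rintro rfl
      exact hzp (L.par_equiv.symm hzt)
    · rintro rfl
      exact hza (eq_of_par hM hz haC.1 hzt)
  obtain ⟨s, hs, hxs, hsp, hsa⟩ := hproj x hx hxp hxa
  obtain ⟨t, ht, hyt, htp, hta⟩ := hproj y hy hyp hya
  obtain ⟨σ, hσ, h1, h2⟩ := h.exists_stabilizer hC haC.2 ha hs hsp hsa ht htp hta
  have hσM := h.image_tangent_self hC hM hMC ha hσ h1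
  refine ⟨σ, hσ, h1, ?_, hσM⟩
  have hpar : L.Par (σ x) t := h2 ▸ ((h.isAut σ hσ).2 x s).1 hxs
  exact eq_of_par hM (hσM ▸ Set.mem_image_of_mem σ hx) hy
    (L.par_equiv.trans hpar (L.par_equiv.symm hyt))

lemma tangent_unique (h : PencilAction L p K Δ) (hM : M ∈ L.Circles) (hp : p ∉ M)
    (hC : C ∈ L.pencil p K) (hD : D ∈ L.pencil p K) (hMC : M ∩ C = {a}) (hMD : M ∩ D = {b}) :
    C = D :=
  (h.tangent M hM hp).unique ⟨hC, a, hMC⟩ ⟨hD, b, hMD⟩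

lemma apply_tangent_point (h : PencilAction L p K Δ) (hM : M ∈ L.Circles) (hp : p ∉ M)
    (hC : C ∈ L.pencil p K) (hMC : M ∩ C = {a}) (hσ : σ ∈ Δ) (hσM : σ '' M = M) : σ a = a := by
  have hσMC : M ∩ σ '' C = {σ a} := by
    nth_rw 1 [← hσM]
    rw [← Set.image_inter σ.injective, hMC, Set.image_singleton]
  have hσC := h.tangent_unique hM hp (h.map_pencil σ hσ C hC) hC hσMC hMC
  rw [hσC, hMC] at hσMC
  exact (Set.singleton_eq_singleton_iff.1 hσMC).symm

/-- A circle touching another member of the pencil meets `C` in at least two points or not at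
all. -/
lemma exists_second_point (h : PencilAction L p K Δ) (hM : M ∈ L.Circles) (hp : p ∉ M)
    (hC : C ∈ L.pencil p K) (hD : D ∈ L.pencil p K) (hMD : M ∩ D = {a}) (hCD : C ≠ D)
    (hx : x ∈ M) (hxC : x ∈ C) : ∃ y ∈ M, y ∈ C ∧ y ≠ x := by
  by_contra! hcon
  refine hCD (h.tangent_unique hM hp hC hD (a := x) ?_ hMD)
  ext z
  exact ⟨fun hz => hcon z hz.1 hz.2, fun hz => by rw [hz]; exact ⟨hx, hxC⟩⟩

lemma image_eq_of_two_fixed_or_swapped (h : PencilAction L p K Δ) (hM : M ∈ L.Circles)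
    (hc : c ∈ M) (hd : d ∈ M) (hcd : c ≠ d) (hcp : ¬ L.Par p c) (hdp : ¬ L.Par p d) (hσ : σ ∈ Δ)
    (hσc : σ c ∈ ({c, d} : Set P)) (hσd : σ d ∈ ({c, d} : Set P)) : σ '' M = M := by
  obtain ⟨u, huM, hu⟩ := exists_par_mem hM p
  have huc : c ≠ u := fun h => hcp (h ▸ hu)
  have hud : d ≠ u := fun h => hdp (h ▸ hu)
  have hsub : ({c, d} : Set P) ⊆ σ '' {c, d} := by
    have hne := σ.injective.ne hcd
    intro z hz
    simp only [Set.mem_insert_iff, Set.mem_singleton_iff] at hσc hσd hz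
    simp only [Set.image_insert_eq, Set.image_singleton, Set.mem_insert_iff,
      Set.mem_singleton_iff]
    grind
  have hsub' : σ '' {c, d} ⊆ σ '' M := Set.image_mono (by
    rintro z (rfl | rfl)
    exacts [hc, hd])
  exact eq_of_three_mem (((h.isAut σ hσ).1 M).1 hM) hM hcd hud huc
    (hsub' (hsub (by simp))) (hsub' (hsub (by simp))) ⟨u, huM, h.fix σ hσ u hu⟩ hc hd huM

lemma inter_eq_pair (h : PencilAction L p K Δ) (hM : M ∈ L.Circles) (hp : p ∉ M)
    (hC : C ∈ L.pencil p K) (hcM : c ∈ M) (hcC : c ∈ C) (hdM : d ∈ M) (hdC : d ∈ C)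
    (hcd : c ≠ d) (hx : x ∈ M) (hxC : x ∈ C) : x ∈ ({c, d} : Set P) := by
  by_contra hcon
  simp only [Set.mem_insert_iff, Set.mem_singleton_iff, not_or] at hcon
  exact hp ((eq_of_three_mem hM (circle_of_mem_pencil h.circle hC) hcd (Ne.symm hcon.2)
    (Ne.symm hcon.1) hcM hdM hx hcC hdC hxC).symm ▸ mem_of_mem_pencil h.mem hC)

/-- All circles through two points of a member `C` of the pencil touch the members of the pencil
at parallel points. -/
lemma par_tangent_points (h : PencilAction L p K Δ) (hC : C ∈ L.pencil p K)
    (hcC : c ∈ C) (hdC : d ∈ C) (hcd : c ≠ d)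
    {D' : Set P} (hM : M ∈ L.Circles) (hN : N ∈ L.Circles) (hpM : p ∉ M) (hpN : p ∉ N)
    (hD : D ∈ L.pencil p K) (hD' : D' ∈ L.pencil p K) (hMD : M ∩ D = {a}) (hND : N ∩ D' = {b})
    (hcM : c ∈ M) (hdM : d ∈ M) (hcN : c ∈ N) (hdN : d ∈ N) : L.Par a b := by
  by_contra hab
  have haD : a ∈ M ∩ D := hMD ▸ rfl
  have hbD : b ∈ N ∩ D' := hND ▸ rfl
  have hap : a ≠ p := fun h => hpM (h ▸ haD.1)
  have hbp : b ≠ p := fun h => hpN (h ▸ hbD.1)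
  have hcp : c ≠ p := fun h => hpM (h ▸ hcM)
  have hdp : d ≠ p := fun h => hpM (h ▸ hdM)
  have hCD : C ≠ D := by
    rintro rfl
    have h1 : c = a := hMD.subset ⟨hcM, hcC⟩
    have h2 : d = a := hMD.subset ⟨hdM, hdC⟩
    exact hcd (h1.trans h2.symm)
  have hCc := circle_of_mem_pencil h.circle hC
  have hDc := circle_of_mem_pencil h.circle hD
  obtain ⟨z, hz, hbz⟩ := exists_par_mem hCc b
  have hzp : z ≠ p := by
    rintro rfl
    exact h.not_par hD' hbD.2 hbp (L.par_equiv.symm hbz)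
  have hzD : z ∉ D := fun hzD => hCD (eq_of_mem_pencil h.circle hC hD hzp hz hzD)
  have haz : ¬ L.Par a z := fun haz => hab (L.par_equiv.trans haz (L.par_equiv.symm hbz))
  obtain ⟨T, ⟨hT, hzT, hDT⟩, -⟩ := L.touching D hDc a haD.2 z hzD haz
  rw [Set.inter_comm] at hDT
  have hpT := h.notMem_of_tangent hD hDT hap
  obtain ⟨t, htT, htC, htz⟩ := h.exists_second_point hT hpT hC hD hDT hCD hzT hz
  have htp : t ≠ p := fun h => hpT (h ▸ htT)
  have hne : ∀ s ∈ C, s ≠ p → s ≠ a := by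
    rintro s hs hsp rfl
    exact hCD (eq_of_mem_pencil h.circle hC hD hsp hs haD.2)
  obtain ⟨σ, hσ, hσa, hσz, -⟩ := h.exists_stabilizer_tangent hD hT hDT hap hzT
    (h.not_par hC hz hzp) (hne z hz hzp) htT (h.not_par hC htC htp) (hne t htC htp)
  have hσC : σ '' C = C := h.image_eq hC hC hσ hz (hσz ▸ htC) (hσz ▸ htp)
  have hσM : σ '' M = M := h.image_tangent_self hD hM hMD hap hσ hσa
  have hpair : ∀ s ∈ M, s ∈ C → σ s ∈ ({c, d} : Set P) := fun s hsM hsC =>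
    h.inter_eq_pair hM hpM hC hcM hcC hdM hdC hcd
      (hσM ▸ Set.mem_image_of_mem σ hsM) (hσC ▸ Set.mem_image_of_mem σ hsC)
  have hσN : σ '' N = N := h.image_eq_of_two_fixed_or_swapped hN hcN hdN hcd
    (h.not_par hC hcC hcp) (h.not_par hC hdC hdp) hσ (hpair c hcM hcC) (hpair d hdM hdC)
  have hσb := h.apply_tangent_point hN hpN hD' hND hσ hσN
  have hbt : L.Par b t := by
    have := ((h.isAut σ hσ).2 b z).1 hbz
    rwa [hσb, hσz] at this
  exact htz (eq_of_par hCc htC hz (L.par_equiv.trans (L.par_equiv.symm hbt) hbz))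

/-- The stabilizer of two members of the pencil is transitive on the points of each of them. -/
lemma exists_fix_pair (h : PencilAction L p K Δ) (hC : C ∈ L.pencil p K) (hD : D ∈ L.pencil p K)
    (hCD : C ≠ D) (hu : L.Par p u) (hup : u ≠ p) (hx : x ∈ C) (hxp : x ≠ p) (hy : y ∈ C)
    (hyp : y ≠ p) : ∃ σ ∈ Δ, σ '' C = C ∧ σ '' D = D ∧ σ x = y := by
  by_cases hxy : x = y
  · exact ⟨1, Δ.one_mem, by simp, by simp, by simpa using hxy⟩
  have hCc := circle_of_mem_pencil h.circle hC
  have hDc := circle_of_mem_pencil h.circle hD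
  obtain ⟨c, hc, hxc⟩ := exists_par_mem hDc x
  obtain ⟨d, hd, hyd⟩ := exists_par_mem hDc y
  have hcd : c ≠ d := by
    rintro rfl
    exact hxy (eq_of_par hCc hx hy (L.par_equiv.trans hxc (L.par_equiv.symm hyd)))
  have hcd' : ¬ L.Par c d := fun h => hcd (eq_of_par hDc hc hd h)
  have hcp : c ≠ p := by
    rintro rfl
    exact h.not_par hC hx hxp (L.par_equiv.symm hxc)
  have hdp : d ≠ p := by
    rintro rfl
    exact h.not_par hC hy hyp (L.par_equiv.symm hyd)
  have hpu : ∀ z, ¬ L.Par p z → ¬ L.Par z u := fun z hz hzu =>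
    hz (L.par_equiv.trans hu (L.par_equiv.symm hzu))
  obtain ⟨M, ⟨hM, hcM, hdM, huM⟩, -⟩ := L.joinCircle c d u hcd'
    (hpu d (h.not_par hD hd hdp)) (hpu c (h.not_par hD hc hcp))
  have hpM : p ∉ M := fun hpM => hup (eq_of_par hM hpM huM hu).symm
  obtain ⟨E, ⟨hE, e, hME⟩, -⟩ := h.tangent M hM hpM
  have heE : e ∈ M ∩ E := hME ▸ rfl
  have hep : e ≠ p := fun h => hpM (h ▸ heE.1)
  have hDE : D ≠ E := by
    rintro rfl
    have h1 : c = e := hME.subset ⟨hcM, hc⟩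
    have h2 : d = e := hME.subset ⟨hdM, hd⟩
    exact hcd (h1.trans h2.symm)
  obtain ⟨m, hm, hem⟩ := exists_par_mem hCc e
  have hmp : m ≠ p := by
    rintro rfl
    exact h.not_par hE heE.2 hep (L.par_equiv.symm hem)
  have hpar : ∀ z ∈ M, z ∈ D → z ≠ p → ¬ L.Par z m := by
    intro z hzM hzD hzp hzm
    have hze := eq_of_par hM hzM heE.1 (L.par_equiv.trans hzm (L.par_equiv.symm hem))
    exact hDE (eq_of_mem_pencil h.circle hD hE hzp hzD (hze ▸ heE.2))
  obtain ⟨N, ⟨hN, hcN, hdN, hmN⟩, -⟩ := L.joinCircle c d m hcd'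
    (hpar d hdM hd hdp) (hpar c hcM hc hcp)
  have hpN : p ∉ N := fun hpN => by
    have hND := eq_of_three_mem hN hDc hcd hdp hcp hcN hdN hpN hc hd
      (mem_of_mem_pencil h.mem hD)
    exact hCD (eq_of_mem_pencil h.circle hC hD hmp hm (hND ▸ hmN))
  obtain ⟨F, ⟨hF, f, hNF⟩, -⟩ := h.tangent N hN hpN
  have hfF : f ∈ N ∩ F := hNF ▸ rfl
  have hfm : f = m := eq_of_par hN hfF.1 hmN (L.par_equiv.trans (L.par_equiv.symm
    (h.par_tangent_points hD hc hd hcd hM hN hpM hpN hE hF hME hNF hcM hdM hcN hdN)) hem)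
  subst hfm
  have hFC : F = C := eq_of_mem_pencil h.circle hF hC hmp hfF.2 hm
  subst hFC
  have hne : ∀ s ∈ D, s ≠ p → s ≠ f := by
    rintro s hs hsp rfl
    exact hCD (eq_of_mem_pencil h.circle hF hD hsp hm hs)
  obtain ⟨σ, hσ, hσf, hσc, -⟩ := h.exists_stabilizer_tangent hF hN hNF hmp hcN
    (h.not_par hD hc hcp) (hne c hc hcp) hdN (h.not_par hD hd hdp) (hne d hd hdp)
  have hσF : σ '' F = F := h.image_eq hF hF hσ hm (hσf.symm ▸ hm) (hσf.symm ▸ hmp)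
  refine ⟨σ, hσ, hσF, h.image_eq hD hD hσ hc (hσc ▸ hd) (hσc ▸ hdp), ?_⟩
  have hσx : L.Par (σ x) d := hσc ▸ ((h.isAut σ hσ).2 x c).1 hxc
  exact eq_of_par hCc (hσF ▸ Set.mem_image_of_mem σ hx) hy
    (L.par_equiv.trans hσx (L.par_equiv.symm hyd))

lemma meets_of_meets (h : PencilAction L p K Δ) (hC : C ∈ L.pencil p K)
    (hM : M ∈ L.Circles) (hN : N ∈ L.Circles) (hR : R ∈ L.Circles)
    (hMC : M ∩ C = {a}) (hNC : N ∩ C = {b}) (hRC : R ∩ C = {c})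
    (ha : a ≠ p) (hb : b ≠ p) (hc : c ≠ p) (hac : a ≠ c) (hbc : b ≠ c)
    (hu : L.Par p u) (huM : u ∈ M) (huN : u ∈ N) (hMR : (M ∩ R).Nonempty) :
    (N ∩ R).Nonempty := by
  have haC : a ∈ M ∩ C := hMC ▸ rfl
  have hbC : b ∈ N ∩ C := hNC ▸ rfl
  have hcC : c ∈ R ∩ C := hRC ▸ rfl
  obtain ⟨σ, hσ, hσc, hσa⟩ := h.exists_stabilizer hC hcC.2 hc haC.2 ha hac hbC.2 hb hbc
  rw [← h.image_tangent_eq hC hM hN hMC hNC hb hu huM huN hσ hσa,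
    ← h.image_tangent_self hC hR hRC hc hσ hσc, ← Set.image_inter σ.injective]
  exact hMR.image σ

lemma image_inter_eq (h : PencilAction L p K Δ) (hC : C ∈ L.pencil p K) (hMC : M ∩ C = {a})
    (hσ : σ ∈ Δ) (hx : x ∈ C) (hσx : σ x ∈ C) (hp : σ x ≠ p) : σ '' M ∩ C = {σ a} := by
  nth_rw 1 [← h.image_eq hC hC hσ hx hσx hp]
  rw [← Set.image_inter σ.injective, hMC, Set.image_singleton]

lemma apply_ne (h : PencilAction L p K Δ) (hσ : σ ∈ Δ) (hx : x ≠ p) : σ x ≠ p := fun hx' =>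
  hx (σ.injective (hx'.trans (h.fix σ hσ p (L.par_equiv.refl p)).symm))

/-- If the image of `M` under an element of `Δ` fixing `C` meets `R` in a point outside `C`, then
`M` itself meets `R`. -/
lemma meets_of_image_meets (h : PencilAction L p K Δ) (hC : C ∈ L.pencil p K)
    (hM : M ∈ L.Circles) (hR : R ∈ L.Circles) (hMC : M ∩ C = {a}) (hRC : R ∩ C = {c})
    (ha : a ≠ p) (hc : c ≠ p) (hac : a ≠ c) (hσ : σ ∈ Δ) (hσC : σ '' C = C)
    (hxM : x ∈ σ '' M) (hxR : x ∈ R) (hxC : x ∉ C) : (M ∩ R).Nonempty := by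
  have haC : a ∈ M ∩ C := hMC ▸ rfl
  have hσa : σ a ∈ C := hσC ▸ Set.mem_image_of_mem σ haC.2
  have hσM : σ '' M ∩ C = {σ a} := h.image_inter_eq hC hMC hσ haC.2 hσa (h.apply_ne hσ ha)
  have hσMc : σ '' M ∈ L.Circles := ((h.isAut σ hσ).1 M).1 hM
  obtain ⟨u, huM, hu⟩ := exists_par_mem hM p
  have huσ : u ∈ σ '' M := ⟨u, huM, h.fix σ hσ u hu⟩
  by_cases hac' : σ a = c
  · have hMR : σ '' M = R := eq_of_tangent (circle_of_mem_pencil h.circle hC) hσMc hR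
      (hac' ▸ hσM) hRC hxC hxM hxR
    exact ⟨u, huM, hMR ▸ huσ⟩
  · exact h.meets_of_meets hC hσMc hM hR hσM hMC hRC (h.apply_ne hσ ha) ha hc hac' hac hu huσ
      huM ⟨x, hxM, hxR⟩

lemma meets_trans_of_ne (h : PencilAction L p K Δ) (hC : C ∈ L.pencil p K)
    (hM : M ∈ L.Circles) (hN : N ∈ L.Circles) (hR : R ∈ L.Circles)
    (hMC : M ∩ C = {a}) (hNC : N ∩ C = {b}) (hRC : R ∩ C = {c})
    (ha : a ≠ p) (hb : b ≠ p) (hc : c ≠ p) (hab : a ≠ b) (hbc : b ≠ c) (hac : a ≠ c)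
    (hNM : (N ∩ M).Nonempty) (hNR : (N ∩ R).Nonempty) : (M ∩ R).Nonempty := by
  obtain ⟨x, hxN, hxM⟩ := id hNM
  obtain ⟨y, hyN, hyR⟩ := id hNR
  by_cases hx : L.Par p x
  · exact h.meets_of_meets hC hN hM hR hNC hMC hRC hb ha hc hbc hac hx hxN hxM hNR
  by_cases hy : L.Par p y
  · rw [Set.inter_comm]
    exact h.meets_of_meets hC hN hR hM hNC hRC hMC hb hc ha hab.symm hac.symm hy hyN hyR hNM
  have hbC : b ∈ N ∩ C := hNC ▸ rfl
  have hxC : x ∉ C := fun hxC =>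
    hab ((hMC.subset ⟨hxM, hxC⟩ : x = a).symm.trans (hNC.subset ⟨hxN, hxC⟩))
  have hyb : y ≠ b := by
    rintro rfl
    exact hbc (hRC.subset ⟨hyR, hbC.2⟩)
  have hxb : x ≠ b := fun h => hxC (h ▸ hbC.2)
  obtain ⟨σ, hσ, hσb, hσy, -⟩ :=
    h.exists_stabilizer_tangent hC hN hNC hb hyN hy hyb hxN hx hxb
  rw [Set.inter_comm]
  exact h.meets_of_image_meets hC hR hM hRC hMC hc ha hac.symm hσ
    (h.image_eq hC hC hσ hbC.2 (hσb.symm ▸ hbC.2) (hσb.symm ▸ hb)) ⟨y, hyR, hσy⟩ hxM hxC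

lemma mem_pencil_of_tangent (h : PencilAction L p K Δ) (hC : C ∈ L.pencil p K)
    (hM : M ∈ L.Circles) (hMC : M ∩ C = {p}) : M ∈ L.pencil p K := by
  have hpM : p ∈ M ∩ C := hMC ▸ rfl
  by_cases hMK : M = K
  · exact Or.inl hMK
  refine Or.inr ⟨hM, ?_⟩
  ext z
  refine ⟨fun hz => ?_, fun hz => by rw [hz]; exact ⟨hpM.1, h.mem⟩⟩
  by_contra hzp
  rcases hC with rfl | ⟨hC, hCK⟩
  · exact hzp (hMC.subset hz)
  · have hKC : K ∩ C = {p} := Set.inter_comm K C ▸ hCK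
    exact hMK (eq_of_tangent hC hM h.circle hMC hKC
      (fun hzC => hzp (hMC.subset ⟨hz.1, hzC⟩)) hz.1 hz.2)

lemma exists_par_ne_of_tangent (h : PencilAction L p K Δ) (hC : C ∈ L.pencil p K)
    (hM : M ∈ L.Circles) (hMC : M ∩ C = {a}) (ha : a ≠ p) : ∃ u, L.Par p u ∧ u ≠ p := by
  obtain ⟨u, huM, hu⟩ := exists_par_mem hM p
  exact ⟨u, hu, fun hup => h.notMem_of_tangent hC hMC ha (hup ▸ huM)⟩

lemma meets_pencil_of_meets (h : PencilAction L p K Δ) (hC : C ∈ L.pencil p K)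
    (hD : D ∈ L.pencil p K) (hCD : C ≠ D)
    (hM : M ∈ L.Circles) (hN : N ∈ L.Circles) (hMC : M ∩ C = {a}) (hNC : N ∩ C = {b})
    (ha : a ≠ p) (hb : b ≠ p) (hu : L.Par p u) (huM : u ∈ M) (huN : u ∈ N)
    (hMD : (M ∩ D).Nonempty) : (N ∩ D).Nonempty := by
  have haC : a ∈ M ∩ C := hMC ▸ rfl
  have hbC : b ∈ N ∩ C := hNC ▸ rfl
  have hup : u ≠ p := fun hup => h.notMem_of_tangent hC hMC ha (hup ▸ huM)
  obtain ⟨σ, hσ, -, hσD, hσa⟩ := h.exists_fix_pair hC hD hCD hu hup haC.2 ha hbC.2 hb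
  rw [← h.image_tangent_eq hC hM hN hMC hNC hb hu huM huN hσ hσa, ← hσD,
    ← Set.image_inter σ.injective]
  exact hMD.image σ

lemma meets_trans_pencil_left (h : PencilAction L p K Δ) (hC : C ∈ L.pencil p K)
    (hD : D ∈ L.pencil p K) (hCD : C ≠ D) (hN : N ∈ L.Circles) (hR : R ∈ L.Circles)
    (hNC : N ∩ C = {b}) (hRC : R ∩ C = {c}) (hb : b ≠ p) (hc : c ≠ p) (hbc : b ≠ c)
    (hND : (N ∩ D).Nonempty) (hNR : (N ∩ R).Nonempty) : (R ∩ D).Nonempty := by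
  obtain ⟨y, hyN, hyR⟩ := hNR
  by_cases hy : L.Par p y
  · exact h.meets_pencil_of_meets hC hD hCD hN hR hNC hRC hb hc hy hyN hyR hND
  obtain ⟨x, hxN, hxD⟩ := hND
  have hbC : b ∈ N ∩ C := hNC ▸ rfl
  have hcC : c ∈ R ∩ C := hRC ▸ rfl
  have hxp : x ≠ p := fun hxp => h.notMem_of_tangent hC hNC hb (hxp ▸ hxN)
  have hyb : y ≠ b := by
    rintro rfl
    exact hbc (hRC.subset ⟨hyR, hbC.2⟩)
  have hxb : x ≠ b := by
    rintro rfl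
    exact hCD (eq_of_mem_pencil h.circle hC hD hxp hbC.2 hxD)
  obtain ⟨σ, hσ, hσb, hσy, -⟩ :=
    h.exists_stabilizer_tangent hC hN hNC hb hyN hy hyb hxN (h.not_par hD hxD hxp) hxb
  obtain ⟨u, huR, hu⟩ := exists_par_mem hR p
  exact h.meets_pencil_of_meets hC hD hCD (((h.isAut σ hσ).1 R).1 hR) hR
    (h.image_inter_eq hC hRC hσ hbC.2 (hσb.symm ▸ hbC.2) (hσb.symm ▸ hb)) hRC
    (h.apply_ne hσ hc) hc hu ⟨u, huR, h.fix σ hσ u hu⟩ huR ⟨x, ⟨y, hyR, hσy⟩, hxD⟩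

lemma meets_trans_pencil_mid (h : PencilAction L p K Δ) (hC : C ∈ L.pencil p K)
    (hD : D ∈ L.pencil p K) (hCD : C ≠ D) (hM : M ∈ L.Circles) (hR : R ∈ L.Circles)
    (hMC : M ∩ C = {a}) (hRC : R ∩ C = {c}) (ha : a ≠ p) (hc : c ≠ p) (hac : a ≠ c)
    (hDM : (D ∩ M).Nonempty) (hDR : (D ∩ R).Nonempty) : (M ∩ R).Nonempty := by
  obtain ⟨x, hxD, hxM⟩ := hDM
  obtain ⟨y, hyD, hyR⟩ := hDR
  have hxp : x ≠ p := fun hxp => h.notMem_of_tangent hC hMC ha (hxp ▸ hxM)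
  have hyp : y ≠ p := fun hyp => h.notMem_of_tangent hC hRC hc (hyp ▸ hyR)
  obtain ⟨u, hu, hup⟩ := h.exists_par_ne_of_tangent hC hM hMC ha
  obtain ⟨σ, hσ, -, hσC, hσx⟩ := h.exists_fix_pair hD hC hCD.symm hu hup hxD hxp hyD hyp
  exact h.meets_of_image_meets hC hM hR hMC hRC ha hc hac hσ hσC ⟨x, hxM, hσx⟩ hyR
    (fun hyC => hCD (eq_of_mem_pencil h.circle hC hD hyp hyC hyD))

end PencilAction

end LaguerrePlane

open LaguerrePlane

/-- assume (A3).  If P₀, Q, R are tangent to a circle C ∈ ⟨p,K⟩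
at pairwise distinct points and Q meets both P₀ and R, then P₀ meets R. -/
theorem tangent_circles_meeting_transitive
    {P : Type*} (L : LaguerrePlane P) (p : P) (K : Set P)
    (Δ : Subgroup (Equiv.Perm P))
    (hK : K ∈ L.Circles) (hpK : p ∈ K)
    (haut : ∀ σ ∈ Δ, L.IsAut σ)
    (hfix : ∀ σ ∈ Δ, ∀ q, L.Par p q → σ q = q)
    (hpen : ∀ σ ∈ Δ, ∀ M ∈ L.pencil p K, ⇑σ '' M ∈ L.pencil p K)
    (hA1 : ∀ x y : P, ¬ L.Par p x → ¬ L.Par p y → ∃ σ ∈ Δ, σ x = y)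
    (hA2 : ∀ r ∈ K, r ≠ p → ∀ x ∈ K, x ≠ p → x ≠ r → ∀ y ∈ K, y ≠ p → y ≠ r →
      ∃ σ ∈ Δ, σ r = r ∧ σ x = y)    (hA3 : ∀ M ∈ L.Circles, p ∉ M → ∃! N, N ∈ L.pencil p K ∧ ∃ z, M ∩ N = {z})    :
    ∀ C ∈ L.pencil p K, ∀ P₀ ∈ L.Circles, ∀ Q ∈ L.Circles, ∀ R ∈ L.Circles,
    ∀ a b c : P, a ≠ b → b ≠ c → a ≠ c →
    P₀ ∩ C = {a} → Q ∩ C = {b} → R ∩ C = {c} →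
    (Q ∩ P₀).Nonempty → (Q ∩ R).Nonempty → (P₀ ∩ R).Nonempty := by
  have h : PencilAction L p K Δ := ⟨hK, hpK, haut, hfix, hpen, hA1, hA2, hA3⟩
  intro C hC M hM N hN R hR a b c hab hbc hac hMC hNC hRC hNM hNR
  have hbC : b ∈ N ∩ C := hNC ▸ rfl
  have hcC : c ∈ R ∩ C := hRC ▸ rfl
  have hne : ∀ D e, D ∩ C = {p} → e ∈ C → e ≠ p → C ≠ D := by
    rintro D e hDC heC hep rfl
    exact hep (hDC.subset ⟨heC, heC⟩)
  by_cases ha : a = p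
  · subst ha
    rw [Set.inter_comm]
    exact h.meets_trans_pencil_left hC (h.mem_pencil_of_tangent hC hM hMC)
      (hne M b hMC hbC.2 hab.symm) hN hR hNC hRC hab.symm hac.symm hbc hNM hNR
  by_cases hb : b = p
  · subst hb
    exact h.meets_trans_pencil_mid hC (h.mem_pencil_of_tangent hC hN hNC)
      (hne N c hNC hcC.2 hbc.symm) hM hR hMC hRC hab hbc.symm hac hNM hNR
  by_cases hc : c = p
  · subst hc
    exact h.meets_trans_pencil_left hC (h.mem_pencil_of_tangent hC hR hRC)
      (hne R b hRC hbC.2 hbc) hN hM hNC hMC hbc hac hab.symm hNR hNM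
  exact h.meets_trans_of_ne hC hM hN hR hMC hNC hRC ha hb hc hab hbc hac hNM hNR
end

section
/- Assume (A3). Let L ∈ ⟨p,K⟩, let x be a point parallel to p with x ≠ p, and let y ∉ L be a point not parallel to x. Then x ≡_L y if and only if there are exactly two circles tangent to L that contain both x and y. -/
open LaguerrePlane

/-- a ≡_C b : every circle through a tangent to C meets every circle through b
tangent to C. -/
def tangentEquiv {P : Type*} (L : LaguerrePlane P) (C : Set P) (a b : P) :
    Prop :=
  ∀ M ∈ L.Circles, ∀ N ∈ L.Circles, a ∈ M → b ∈ N →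
    (∃ z, M ∩ C = {z}) → (∃ z, N ∩ C = {z}) → (M ∩ N).Nonempty

namespace LaguerrePlane

section Basic

variable {P : Type*} {L : LaguerrePlane P}

theorem par_refl (a : P) : L.Par a a := L.par_equiv.refl a

theorem Par.symm {a b : P} (h : L.Par a b) : L.Par b a := L.par_equiv.symm h

theorem Par.trans {a b c : P} (h : L.Par a b) (h' : L.Par b c) : L.Par a c :=
  L.par_equiv.trans h h'

theorem eq_of_par_s17 {C : Set P} (hC : C ∈ L.Circles) {a b : P} (ha : a ∈ C) (hb : b ∈ C)
    (h : L.Par a b) : a = b :=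
  (L.parPoint a C hC).unique ⟨par_refl a, ha⟩ ⟨h, hb⟩

theorem exists_par (a : P) {C : Set P} (hC : C ∈ L.Circles) : ∃ q ∈ C, L.Par a q := by
  obtain ⟨q, ⟨h, hq⟩, -⟩ := L.parPoint a C hC
  exact ⟨q, hq, h⟩

theorem circle_eq {M N : Set P} (hM : M ∈ L.Circles) (hN : N ∈ L.Circles) {a b c : P}
    (hab : a ≠ b) (hbc : b ≠ c) (hac : a ≠ c) (haM : a ∈ M) (hbM : b ∈ M) (hcM : c ∈ M)
    (haN : a ∈ N) (hbN : b ∈ N) (hcN : c ∈ N) : M = N :=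
  (L.joinCircle a b c (fun h => hab (eq_of_par_s17 hM haM hbM h))
    (fun h => hbc (eq_of_par_s17 hM hbM hcM h)) (fun h => hac (eq_of_par_s17 hM haM hcM h))).unique
    ⟨hM, haM, hbM, hcM⟩ ⟨hN, haN, hbN, hcN⟩

theorem left_mem_of_inter_eq {M C : Set P} {z : P} (h : M ∩ C = {z}) : z ∈ M :=
  (h.symm ▸ Set.mem_singleton z : z ∈ M ∩ C).1

theorem right_mem_of_inter_eq {M C : Set P} {z : P} (h : M ∩ C = {z}) : z ∈ C :=
  (h.symm ▸ Set.mem_singleton z : z ∈ M ∩ C).2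

theorem eq_of_mem_inter {M C : Set P} {z q : P} (h : M ∩ C = {z}) (hM : q ∈ M) (hC : q ∈ C) :
    q = z := by
  have : q ∈ M ∩ C := ⟨hM, hC⟩
  rwa [h] at this

theorem tangent_unique {C M N : Set P} (hC : C ∈ L.Circles) (hM : M ∈ L.Circles)
    (hN : N ∈ L.Circles) {z q : P} (hq : q ∉ C) (hqM : q ∈ M) (hqN : q ∈ N)
    (hMC : M ∩ C = {z}) (hNC : N ∩ C = {z}) : M = N := by
  have hz := right_mem_of_inter_eq hMC
  refine (L.touching C hC z hz q hq fun h => hq ?_).unique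
    ⟨hM, hqM, by rwa [Set.inter_comm]⟩ ⟨hN, hqN, by rwa [Set.inter_comm]⟩
  exact eq_of_par_s17 hM (left_mem_of_inter_eq hMC) hqM h ▸ hz

theorem exists_tangent {C : Set P} (hC : C ∈ L.Circles) {z q : P} (hz : z ∈ C) (hq : q ∉ C)
    (h : ¬ L.Par z q) : ∃ M ∈ L.Circles, q ∈ M ∧ M ∩ C = {z} := by
  obtain ⟨M, ⟨hM, hqM, hMC⟩, -⟩ := L.touching C hC z hz q hq h
  exact ⟨M, hM, hqM, by rwa [Set.inter_comm]⟩

theorem exists_mem_not_par (p : P) {C : Set P} (hC : C ∈ L.Circles) :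
    ∃ q ∈ C, ¬ L.Par p q := by
  obtain ⟨D, hD, ⟨a, b, -, ha, hb, -, hab, -, -⟩, -⟩ := L.nontriv
  obtain ⟨a', ha', haa'⟩ := exists_par a hC
  obtain ⟨b', hb', hbb'⟩ := exists_par b hC
  by_cases h : L.Par p a'
  · refine ⟨b', hb', fun h' => hab (eq_of_par_s17 hD ha hb ?_)⟩
    exact (haa'.trans h.symm).trans (h'.trans hbb'.symm)
  · exact ⟨a', ha', h⟩

end Basic

/-- A group `Δ` of automorphisms satisfying (A1), (A2), in a Laguerre plane satisfying (A3). -/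
structure IsResidual {P : Type*} (L : LaguerrePlane P) (p : P) (K : Set P)
    (Δ : Subgroup (Equiv.Perm P)) : Prop where
  circle : K ∈ L.Circles
  mem : p ∈ K
  aut : ∀ σ ∈ Δ, L.IsAut σ
  fix : ∀ σ ∈ Δ, ∀ q, L.Par p q → σ q = q
  pen : ∀ σ ∈ Δ, ∀ M ∈ L.pencil p K, ⇑σ '' M ∈ L.pencil p K
  transitive : ∀ x y : P, ¬ L.Par p x → ¬ L.Par p y → ∃ σ ∈ Δ, σ x = y
  stabilizer : ∀ r ∈ K, r ≠ p → ∀ x ∈ K, x ≠ p → x ≠ r → ∀ y ∈ K, y ≠ p → y ≠ r →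
      ∃ σ ∈ Δ, σ r = r ∧ σ x = y
  tangent : ∀ M ∈ L.Circles, p ∉ M → ∃! N, N ∈ L.pencil p K ∧ ∃ z, M ∩ N = {z}

/-- `m` is the point where the circle through `e`, `c`, `x` touches the pencil circle `N`. -/
def IsTouchPoint {P : Type*} (L : LaguerrePlane P) (p : P) (K : Set P) (x e c : P)
    (N : Set P) (m : P) : Prop :=
  ∃ F ∈ L.Circles, e ∈ F ∧ c ∈ F ∧ x ∈ F ∧ N ∈ L.pencil p K ∧ F ∩ N = {m}

theorem IsTouchPoint.symm {P : Type*} {L : LaguerrePlane P} {p : P} {K : Set P} {x e c m : P}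
    {N : Set P}
    (hm : L.IsTouchPoint p K x e c N m) : L.IsTouchPoint p K x c e N m := by
  obtain ⟨F, hF, he, hc, hx, hN, hFN⟩ := hm
  exact ⟨F, hF, hc, he, hx, hN, hFN⟩

namespace IsResidual

variable {P : Type*} {L : LaguerrePlane P} {p : P} {K : Set P} {Δ : Subgroup (Equiv.Perm P)}
  {σ : Equiv.Perm P}

theorem circle_of_pencil (h : L.IsResidual p K Δ) {C : Set P} (hC : C ∈ L.pencil p K) :
    C ∈ L.Circles := by
  rcases hC with rfl | hC
  exacts [h.circle, hC.1]

theorem mem_of_pencil (h : L.IsResidual p K Δ) {C : Set P} (hC : C ∈ L.pencil p K) : p ∈ C := by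
  rcases hC with rfl | hC
  exacts [h.mem, left_mem_of_inter_eq hC.2]

theorem not_par (h : L.IsResidual p K Δ) {C : Set P} (hC : C ∈ L.pencil p K) {q : P}
    (hq : q ∈ C) (hqp : q ≠ p) : ¬ L.Par p q := fun hp =>
  hqp (eq_of_par_s17 (h.circle_of_pencil hC) (h.mem_of_pencil hC) hq hp).symm

theorem pencil_unique (h : L.IsResidual p K Δ) {C D : Set P} (hC : C ∈ L.pencil p K)
    (hD : D ∈ L.pencil p K) {q : P} (hqC : q ∈ C) (hqD : q ∈ D) (hqp : q ≠ p) : C = D := by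
  by_cases hq : q ∈ K
  · have key : ∀ M ∈ L.pencil p K, q ∈ M → M = K := by
      rintro M (rfl | hM) hqM
      · rfl
      · exact absurd (eq_of_mem_inter hM.2 hqM hq) hqp
    rw [key C hC hqC, key D hD hqD]
  · have key : ∀ M ∈ L.pencil p K, q ∈ M → M ∩ K = {p} := by
      rintro M (rfl | hM) hqM
      · exact absurd hqM hq
      · exact hM.2
    exact tangent_unique h.circle (h.circle_of_pencil hC) (h.circle_of_pencil hD) hq hqC hqD
      (key C hC hqC) (key D hD hqD)

theorem exists_pencil (h : L.IsResidual p K Δ) {q : P} (hq : ¬ L.Par p q) :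
    ∃ C ∈ L.pencil p K, q ∈ C := by
  by_cases hqK : q ∈ K
  · exact ⟨K, Or.inl rfl, hqK⟩
  · obtain ⟨M, hM, hqM, hMK⟩ := exists_tangent h.circle h.mem hqK hq
    exact ⟨M, Or.inr ⟨hM, hMK⟩, hqM⟩

theorem image_circle (h : L.IsResidual p K Δ) (hσ : σ ∈ Δ) {C : Set P} (hC : C ∈ L.Circles) :
    σ '' C ∈ L.Circles := ((h.aut σ hσ).1 C).1 hC

theorem image_par (h : L.IsResidual p K Δ) (hσ : σ ∈ Δ) {x y : P} (hxy : L.Par x y) :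
    L.Par (σ x) (σ y) := ((h.aut σ hσ).2 x y).1 hxy

theorem image_ne (h : L.IsResidual p K Δ) (hσ : σ ∈ Δ) {q : P} (hq : q ≠ p) : σ q ≠ p := by
  intro h'
  rw [← h.fix σ hσ p (par_refl p)] at h'
  exact hq (σ.injective h')

theorem image_inter_eq {M C : Set P} {z : P} (hMC : M ∩ C = {z}) :
    σ '' M ∩ σ '' C = {σ z} := by
  rw [← Set.image_inter σ.injective, hMC, Set.image_singleton]

theorem image_pencil (h : L.IsResidual p K Δ) (hσ : σ ∈ Δ) {C D : Set P}
    (hC : C ∈ L.pencil p K) (hD : D ∈ L.pencil p K) {q : P} (hq : q ∈ C) (hqp : q ≠ p)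
    (hσq : σ q ∈ D) : σ '' C = D :=
  h.pencil_unique (h.pen σ hσ C hC) hD (Set.mem_image_of_mem σ hq) hσq (h.image_ne hσ hqp)

/-- An element of `Δ` fixing `y` fixes every circle tangent at `y` to the pencil circle
through `y`. -/
theorem image_tangent (h : L.IsResidual p K Δ) (hσ : σ ∈ Δ) {Y H : Set P}
    (hY : Y ∈ L.pencil p K) (hH : H ∈ L.Circles) {y : P} (hyp : y ≠ p) (hHY : H ∩ Y = {y})
    (hy : σ y = y) : σ '' H = H := by
  have hyY := right_mem_of_inter_eq hHY
  have hσY : σ '' Y = Y := h.image_pencil hσ hY hY hyY hyp (by rwa [hy])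
  obtain ⟨x, hxH, hx⟩ := exists_par p hH
  have hxY : x ∉ Y := by
    intro hxY
    have := eq_of_par_s17 (h.circle_of_pencil hY) (h.mem_of_pencil hY) hxY hx
    subst this
    exact hyp (eq_of_mem_inter hHY hxH hxY).symm
  refine tangent_unique (h.circle_of_pencil hY) (h.image_circle hσ hH) hH hxY
    ⟨x, hxH, h.fix σ hσ x hx⟩ hxH ?_ hHY
  have := image_inter_eq (σ := σ) hHY
  rwa [hσY, hy] at this

theorem exists_fix_map (h : L.IsResidual p K Δ) {C : Set P} (hC : C ∈ L.pencil p K) {r x y : P}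
    (hr : r ∈ C) (hrp : r ≠ p) (hx : x ∈ C) (hxp : x ≠ p) (hxr : x ≠ r) (hy : y ∈ C)
    (hyp : y ≠ p) (hyr : y ≠ r) : ∃ σ ∈ Δ, σ r = r ∧ σ x = y := by
  obtain ⟨s, hs, hsp⟩ := exists_mem_not_par p h.circle
  obtain ⟨δ, hδ, hδr⟩ := h.transitive r s (h.not_par hC hr hrp) hsp
  have hδC : δ '' C = K := h.image_pencil hδ hC (Or.inl rfl) hr hrp (by rwa [hδr])
  have hmem : ∀ q ∈ C, δ q ∈ K := fun q hq => hδC ▸ Set.mem_image_of_mem δ hq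
  obtain ⟨τ, hτ, hτr, hτx⟩ := h.stabilizer (δ r) (hmem r hr) (h.image_ne hδ hrp)
    (δ x) (hmem x hx) (h.image_ne hδ hxp) (δ.injective.ne hxr)
    (δ y) (hmem y hy) (h.image_ne hδ hyp) (δ.injective.ne hyr)
  refine ⟨δ⁻¹ * τ * δ, Δ.mul_mem (Δ.mul_mem (Δ.inv_mem hδ) hτ) hδ, ?_, ?_⟩
  · simp [hτr]
  · simp [hτx]

theorem exists_swap (h : L.IsResidual p K Δ) {C : Set P} (hC : C ∈ L.pencil p K) {z w : P}
    (hz : z ∈ C) (hzp : z ≠ p) (hw : w ∈ C) (hwp : w ≠ p) (hzw : z ≠ w) :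
    ∃ σ ∈ Δ, σ z = w ∧ σ w = z := by
  obtain ⟨g, hg, hgz⟩ := h.transitive z w (h.not_par hC hz hzp) (h.not_par hC hw hwp)
  have hgC : g '' C = C := h.image_pencil hg hC hC hz hzp (by rwa [hgz])
  have hgw : g w ∈ C := hgC ▸ Set.mem_image_of_mem g hw
  obtain ⟨τ, hτ, hτw, hτv⟩ := h.exists_fix_map hC hw hwp hgw (h.image_ne hg hwp)
    (fun h' => hzw (g.injective (hgz.trans h'.symm))) hz hzp hzw
  exact ⟨τ * g, Δ.mul_mem hτ hg, by simp [hgz, hτw], by simp [hτv]⟩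

/-- The circle through `c` tangent at `y` to the pencil circle through `y`. -/
theorem exists_tangent_circle (h : L.IsResidual p K Δ) {C Y : Set P} (hC : C ∈ L.pencil p K)
    (hY : Y ∈ L.pencil p K) (hCY : C ≠ Y) {y c : P} (hy : y ∈ Y) (hc : c ∈ C)
    (hcp : c ≠ p) (hyc : ¬ L.Par y c) : ∃ H ∈ L.Circles, c ∈ H ∧ H ∩ Y = {y} :=
  exists_tangent (h.circle_of_pencil hY) hy
    (fun hcY => hCY (h.pencil_unique hC hY hc hcY hcp)) hyc

/-- The stabilizer of `y` and `C` in `Δ` moves every point of `C` not parallel to `y`. -/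
theorem exists_fix_move (h : L.IsResidual p K Δ) {C Y : Set P} (hC : C ∈ L.pencil p K)
    (hY : Y ∈ L.pencil p K) (hCY : C ≠ Y) {y c : P} (hy : y ∈ Y) (hyp : y ≠ p) (hc : c ∈ C)
    (hcp : c ≠ p) (hyc : ¬ L.Par y c) : ∃ σ ∈ Δ, σ y = y ∧ σ c ∈ C ∧ σ c ≠ c := by
  have hCc := h.circle_of_pencil hC
  have hYc := h.circle_of_pencil hY
  obtain ⟨H, hH, hcH, hHY⟩ := h.exists_tangent_circle hC hY hCY hy hc hcp hyc
  have hpH : p ∉ H := fun hp => hyp (eq_of_mem_inter hHY hp (h.mem_of_pencil hY)).symm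
  have hex : ∃ c' ∈ H ∩ C, c' ≠ c := by
    by_contra! hall
    have hHC : H ∩ C = {c} := Set.eq_singleton_iff_unique_mem.2 ⟨⟨hcH, hc⟩, hall⟩
    exact hCY ((h.tangent H hH hpH).unique ⟨hC, c, hHC⟩ ⟨hY, y, hHY⟩)
  obtain ⟨c', ⟨hc'H, hc'C⟩, hc'c⟩ := hex
  have hc'p : c' ≠ p := fun h' => hpH (h' ▸ hc'H)
  have hyc' : ¬ L.Par y c' := by
    intro h'
    have hyc'' := eq_of_par_s17 hH (left_mem_of_inter_eq hHY) hc'H h'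
    exact hCY (h.pencil_unique hC hY hc'C (hyc'' ▸ hy) hc'p)
  obtain ⟨d, hdY, hd⟩ := exists_par c hYc
  obtain ⟨d', hd'Y, hd'⟩ := exists_par c' hYc
  obtain ⟨σ, hσ, hσy, hσd⟩ := h.exists_fix_map hY hy hyp hdY
    (fun e => h.not_par hC hc hcp (e ▸ hd.symm)) (fun e => hyc (e ▸ hd.symm)) hd'Y
    (fun e => h.not_par hC hc'C hc'p (e ▸ hd'.symm)) (fun e => hyc' (e ▸ hd'.symm))
  have hσH := h.image_tangent hσ hY hH hyp hHY hσy
  have hσc : σ c = c' := by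
    refine eq_of_par_s17 hH (hσH ▸ Set.mem_image_of_mem σ hcH) hc'H ?_
    exact (hσd ▸ h.image_par hσ hd).trans hd'.symm
  exact ⟨σ, hσ, hσy, hσc ▸ hc'C, hσc ▸ hc'c⟩

/-- The orbits on `C` of the stabilizer of `y` and `C` in `Δ` have at most two points. -/
theorem orbit_le_two (h : L.IsResidual p K Δ) {C Y : Set P} (hC : C ∈ L.pencil p K)
    (hY : Y ∈ L.pencil p K) (hCY : C ≠ Y) {y c : P} (hy : y ∈ Y) (hyp : y ≠ p) (hc : c ∈ C)
    (hcp : c ≠ p) (hyc : ¬ L.Par y c) {τ : Equiv.Perm P} (hσ : σ ∈ Δ) (hτ : τ ∈ Δ)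
    (hσy : σ y = y) (hτy : τ y = y) (hσC : σ c ∈ C) (hτC : τ c ∈ C) (hσc : σ c ≠ c)
    (hτc : τ c ≠ c) : σ c = τ c := by
  by_contra hne
  obtain ⟨H, hH, hcH, hHY⟩ := h.exists_tangent_circle hC hY hCY hy hc hcp hyc
  have key : ∀ g ∈ Δ, g y = y → g c ∈ H := fun g hg hgy =>
    h.image_tangent hg hY hH hyp hHY hgy ▸ Set.mem_image_of_mem g hcH
  have hHC : H = C := circle_eq hH (h.circle_of_pencil hC) hσc.symm hne hτc.symm hcH
    (key σ hσ hσy) (key τ hτ hτy) hc hσC hτC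
  exact hCY (h.pencil_unique hC hY (hHC ▸ left_mem_of_inter_eq hHY) hy hyp)

/-- An element of `Δ` fixing two nonparallel points outside the generator of `p` fixes every
circle of the pencil. -/
theorem image_pencil_of_fix (h : L.IsResidual p K Δ) (hσ : σ ∈ Δ) {C Y : Set P}
    (hC : C ∈ L.pencil p K) (hY : Y ∈ L.pencil p K) {m b : P} (hm : m ∈ C) (hmp : m ≠ p)
    (hbp : ¬ L.Par p b) (hmb : ¬ L.Par m b) (hσm : σ m = m) (hσb : σ b = b) :
    σ '' Y = Y := by
  by_cases hCY : C = Y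
  · subst hCY
    exact h.image_pencil hσ hC hC hm hmp (by rwa [hσm])
  obtain ⟨q, hqY, hbq⟩ := exists_par b (h.circle_of_pencil hY)
  have hqp : q ≠ p := fun e => hbp (e ▸ hbq.symm)
  obtain ⟨H, hH, hqH, hHC⟩ := h.exists_tangent_circle hY hC (Ne.symm hCY) hm hqY hqp
    (fun h' => hmb (h'.trans hbq.symm))
  have hσq : σ q = q := by
    refine eq_of_par_s17 hH (h.image_tangent hσ hC hH hmp hHC hσm ▸ Set.mem_image_of_mem σ hqH)
      hqH ?_
    have := h.image_par hσ hbq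
    rw [hσb] at this
    exact this.symm.trans hbq
  exact h.image_pencil hσ hY hY hqY hqp (by rwa [hσq])

theorem isTouchPoint_image (h : L.IsResidual p K Δ) (hσ : σ ∈ Δ) {x e c m : P} {N : Set P}
    (hx : L.Par p x) (hm : L.IsTouchPoint p K x e c N m) :
    L.IsTouchPoint p K x (σ e) (σ c) (σ '' N) (σ m) := by
  obtain ⟨F, hF, he, hc, hxF, hN, hFN⟩ := hm
  exact ⟨σ '' F, h.image_circle hσ hF, Set.mem_image_of_mem σ he, Set.mem_image_of_mem σ hc,
    ⟨x, hxF, h.fix σ hσ x hx⟩, h.pen σ hσ N hN, image_inter_eq hFN⟩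

theorem not_mem_of_par {x : P} {F : Set P} (hx : L.Par p x) (hxp : x ≠ p) (hF : F ∈ L.Circles)
    (hxF : x ∈ F) : p ∉ F := fun hp => hxp (eq_of_par_s17 hF hp hxF hx).symm

theorem exists_isTouchPoint (h : L.IsResidual p K Δ) {x e c : P} {C : Set P} (hx : L.Par p x)
    (hxp : x ≠ p) (hC : C ∈ L.pencil p K) (he : e ∈ C) (hep : e ≠ p) (hc : c ∈ C)
    (hcp : c ≠ p) (hec : e ≠ c) : ∃ N m, L.IsTouchPoint p K x e c N m := by
  obtain ⟨F, ⟨hF, heF, hcF, hxF⟩, -⟩ := L.joinCircle e c x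
    (fun h' => hec (eq_of_par_s17 (h.circle_of_pencil hC) he hc h'))
    (fun h' => h.not_par hC hc hcp (hx.trans h'.symm))
    (fun h' => h.not_par hC he hep (hx.trans h'.symm))
  obtain ⟨N, ⟨hN, m, hFN⟩, -⟩ := h.tangent F hF (not_mem_of_par hx hxp hF hxF)
  exact ⟨N, m, F, hF, heF, hcF, hxF, hN, hFN⟩

theorem isTouchPoint_unique (h : L.IsResidual p K Δ) {x e c m m' : P} {C N N' : Set P}
    (hx : L.Par p x) (hxp : x ≠ p) (hC : C ∈ L.pencil p K) (he : e ∈ C) (hep : e ≠ p)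
    (hc : c ∈ C) (hcp : c ≠ p) (hec : e ≠ c) (hm : L.IsTouchPoint p K x e c N m)
    (hm' : L.IsTouchPoint p K x e c N' m') : N = N' ∧ m = m' := by
  obtain ⟨F, hF, heF, hcF, hxF, hN, hFN⟩ := hm
  obtain ⟨F', hF', heF', hcF', hxF', hN', hFN'⟩ := hm'
  have hne : ∀ q ∈ C, q ≠ p → q ≠ x := fun q hq hqp hqx => h.not_par hC hq hqp (hqx ▸ hx)
  obtain rfl := circle_eq hF hF' hec (hne c hc hcp) (hne e he hep) heF hcF hxF heF' hcF' hxF'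
  obtain rfl := (h.tangent F hF (not_mem_of_par hx hxp hF hxF)).unique ⟨hN, m, hFN⟩
    ⟨hN', m', hFN'⟩
  exact ⟨rfl, Set.singleton_injective (hFN.symm.trans hFN')⟩

theorem isTouchPoint_spec (h : L.IsResidual p K Δ) {x e c m : P} {C N : Set P}
    (hx : L.Par p x) (hxp : x ≠ p) (hC : C ∈ L.pencil p K) (he : e ∈ C) (hep : e ≠ p)
    (hc : c ∈ C) (hec : e ≠ c) (hm : L.IsTouchPoint p K x e c N m) :
    N ∈ L.pencil p K ∧ C ≠ N ∧ m ∈ N ∧ m ≠ p ∧ ¬ L.Par m e := by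
  obtain ⟨F, hF, heF, hcF, hxF, hN, hFN⟩ := hm
  have hCN : C ≠ N := by
    rintro rfl
    exact hec ((eq_of_mem_inter hFN heF he).trans (eq_of_mem_inter hFN hcF hc).symm)
  have hmF := left_mem_of_inter_eq hFN
  have hmN := right_mem_of_inter_eq hFN
  refine ⟨hN, hCN, hmN, fun e => not_mem_of_par hx hxp hF hxF (e ▸ hmF), fun h' => ?_⟩
  have := eq_of_par_s17 hF hmF heF h'
  exact hCN (h.pencil_unique hC hN he (this ▸ hmN) hep)

/-- The common stabilizer in `Δ` of two circles of the pencil is transitive on the generators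
other than that of `p`. -/
theorem exists_map_of_pencil (h : L.IsResidual p K Δ) {x e c : P} {C Y : Set P}
    (hx : L.Par p x) (hxp : x ≠ p) (hC : C ∈ L.pencil p K) (hY : Y ∈ L.pencil p K)
    (hCY : C ≠ Y) (he : e ∈ C) (hep : e ≠ p) (hc : c ∈ C) (hcp : c ≠ p) :
    ∃ t ∈ Δ, t '' Y = Y ∧ t e = c := by
  by_cases hec : e = c
  · subst hec
    exact ⟨1, Δ.one_mem, by simp, rfl⟩
  have hCc := h.circle_of_pencil hC
  obtain ⟨N, m, hm⟩ := h.exists_isTouchPoint hx hxp hC he hep hc hcp hec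
  obtain ⟨hN, hCN, hmN, hmp, hme⟩ := h.isTouchPoint_spec hx hxp hC he hep hc hec hm
  obtain ⟨-, -, -, -, hmc⟩ := h.isTouchPoint_spec hx hxp hC hc hcp he (Ne.symm hec) hm.symm
  obtain ⟨s, hs, hse, hsc⟩ := h.exists_swap hC he hep hc hcp hec
  have hsm : s m = m := by
    have := (h.isTouchPoint_image hs hx hm).symm
    rw [hse, hsc] at this
    exact (h.isTouchPoint_unique hx hxp hC he hep hc hcp hec this hm).2
  obtain ⟨μ, hμC, hmμ⟩ := exists_par m hCc
  obtain ⟨y, hyY, hmy⟩ := exists_par m (h.circle_of_pencil hY)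
  have hpm := h.not_par hN hmN hmp
  have hμp : μ ≠ p := fun e => hpm (e ▸ hmμ.symm)
  have hyp : y ≠ p := fun e => hpm (e ▸ hmy.symm)
  have hye : ¬ L.Par y e := fun h' => hme (hmy.trans h')
  obtain ⟨t, ht, hty, htC, hte⟩ := h.exists_fix_move hC hY hCY hyY hyp he hep hye
  have htY : t '' Y = Y := h.image_pencil ht hY hY hyY hyp (by rwa [hty])
  have htC' : t '' C = C := h.image_pencil ht hC hC he hep htC
  refine ⟨t, ht, htY, ?_⟩
  by_contra htc
  have htμ : t μ = μ := by
    refine eq_of_par_s17 hCc (htC' ▸ Set.mem_image_of_mem t hμC) hμC ?_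
    have := h.image_par ht (hmy.symm.trans hmμ)
    rw [hty] at this
    exact this.symm.trans (hmy.symm.trans hmμ)
  have htt : t (t e) = e := by
    by_contra hne
    have httC : t (t e) ∈ C := htC' ▸ Set.mem_image_of_mem t htC
    have := h.orbit_le_two hC hY hCY hyY hyp he hep hye ht (Δ.mul_mem ht ht) hty
      (by simp [hty]) htC httC hte hne
    exact hte (t.injective this).symm
  obtain ⟨N', n, hn⟩ := h.exists_isTouchPoint hx hxp hC he hep htC (h.image_ne ht hep) hte.symm
  obtain ⟨hN', -, hnN', hnp, -⟩ := h.isTouchPoint_spec hx hxp hC he hep htC hte.symm hn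
  have htn : t n = n := by
    have := (h.isTouchPoint_image ht hx hn).symm
    rw [htt] at this
    exact (h.isTouchPoint_unique hx hxp hC he hep htC (h.image_ne ht hep) hte.symm this hn).2
  have key : ∀ g : Equiv.Perm P, g ∈ Δ → g '' N = N → g μ = μ → g m = m := by
    intro g hg hgN hgμ
    refine eq_of_par_s17 (h.circle_of_pencil hN) (hgN ▸ Set.mem_image_of_mem g hmN) hmN ?_
    have := h.image_par hg hmμ
    rw [hgμ] at this
    exact this.trans hmμ.symm
  by_cases hnm : L.Par n m
  · obtain ⟨g, hg, hge, hgc⟩ := h.exists_fix_map hC he hep hc hcp (Ne.symm hec) htC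
      (h.image_ne ht hep) hte
    have hgm : g m = n := by
      have := h.isTouchPoint_image hg hx hm
      rw [hge, hgc] at this
      exact (h.isTouchPoint_unique hx hxp hC he hep htC (h.image_ne ht hep) hte.symm this hn).2
    have hgC : g '' C = C := h.image_pencil hg hC hC he hep (by rwa [hge])
    have hgμ : g μ = μ := by
      refine eq_of_par_s17 hCc (hgC ▸ Set.mem_image_of_mem g hμC) hμC ?_
      have := h.image_par hg hmμ
      rw [hgm] at this
      exact this.symm.trans (hnm.trans hmμ)
    have hgN : g '' N = N := h.image_pencil_of_fix hg hC hN he hep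
      (h.not_par hC hμC hμp) (fun h' => hme (hmμ.trans h'.symm)) hge hgμ
    have := h.orbit_le_two hC hN hCN hmN hmp hc hcp hmc hg hs (key g hg hgN hgμ) hsm
      (hgc ▸ htC) (hsc ▸ he) (hgc ▸ htc) (hsc ▸ hec)
    exact hte (hgc.symm.trans (this.trans hsc))
  · have htN : t '' N = N := h.image_pencil_of_fix ht hN' hN hnN' hnp
      (h.not_par hC hμC hμp) (fun h' => hnm (h'.trans hmμ.symm)) htn htμ
    have := h.orbit_le_two hC hN hCN hmN hmp he hep hme ht hs (key t ht htN htμ) hsm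
      htC (hse ▸ hc) hte (hse ▸ Ne.symm hec)
    exact htc (this.trans hse)

/-- If some circle through `x` and `y` is tangent to `C`, then exactly two are. -/
theorem exists_two_tangent (h : L.IsResidual p K Δ) {x y z : P} {C M : Set P}
    (hC : C ∈ L.pencil p K) (hx : L.Par p x) (hxp : x ≠ p) (hyC : y ∉ C) (hxy : ¬ L.Par x y)
    (hM : M ∈ L.Circles) (hxM : x ∈ M) (hyM : y ∈ M) (hMC : M ∩ C = {z}) :
    ∃ M N : Set P, M ≠ N ∧
        (M ∈ L.Circles ∧ x ∈ M ∧ y ∈ M ∧ ∃ z, M ∩ C = {z}) ∧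
        (N ∈ L.Circles ∧ x ∈ N ∧ y ∈ N ∧ ∃ z, N ∩ C = {z}) ∧
        (∀ M' : Set P,
          (M' ∈ L.Circles ∧ x ∈ M' ∧ y ∈ M' ∧ ∃ z, M' ∩ C = {z}) →
          M' = M ∨ M' = N) := by
  have hCc := h.circle_of_pencil hC
  have hpy : ¬ L.Par p y := fun h' => hxy (hx.symm.trans h')
  have hyp : y ≠ p := fun e => hpy (e.symm ▸ par_refl p : L.Par p y)
  obtain ⟨Y, hY, hyY⟩ := h.exists_pencil hpy
  have hCY : C ≠ Y := fun e => hyC (e ▸ hyY)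
  have hxC : x ∉ C := fun hxC => hxp (eq_of_par_s17 hCc (h.mem_of_pencil hC) hxC hx).symm
  have hzM := left_mem_of_inter_eq hMC
  have hzC := right_mem_of_inter_eq hMC
  have hzp : z ≠ p := fun e => not_mem_of_par hx hxp hM hxM (e ▸ hzM)
  have hyz : ¬ L.Par y z := fun h' => hyC (eq_of_par_s17 hM hyM hzM h' ▸ hzC)
  obtain ⟨g, hg, hgy, hgC, hgz⟩ := h.exists_fix_move hC hY hCY hyY hyp hzC hzp hyz
  have himage : ∀ σ ∈ Δ, ∀ D ∈ L.Circles, x ∈ D → ∀ w, w ≠ p → D ∩ C = {w} → σ w ∈ C →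
      σ '' D ∈ L.Circles ∧ x ∈ σ '' D ∧ σ '' D ∩ C = {σ w} := by
    intro σ hσ D hD hxD w hwp hDC hσw
    refine ⟨h.image_circle hσ hD, ⟨x, hxD, h.fix σ hσ x hx⟩, ?_⟩
    have := image_inter_eq (σ := σ) hDC
    rwa [h.image_pencil hσ hC hC (right_mem_of_inter_eq hDC) hwp hσw] at this
  obtain ⟨hgM, hxgM, hgMC⟩ := himage g hg M hM hxM z hzp hMC hgC
  refine ⟨M, g '' M, fun e => ?_, ⟨hM, hxM, hyM, z, hMC⟩,
    ⟨hgM, hxgM, ⟨y, hyM, hgy⟩, g z, hgMC⟩, ?_⟩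
  · rw [← e, hMC] at hgMC
    exact hgz (Set.singleton_injective hgMC).symm
  rintro M' ⟨hM', hxM', hyM', w, hM'C⟩
  by_cases hwz : w = z
  · subst hwz
    exact Or.inl (tangent_unique hCc hM' hM hxC hxM' hxM hM'C hMC)
  have hwC := right_mem_of_inter_eq hM'C
  have hwp : w ≠ p := fun e =>
    not_mem_of_par hx hxp hM' hxM' (e ▸ left_mem_of_inter_eq hM'C)
  obtain ⟨s, hs, hsz, hsw⟩ := h.exists_swap hC hzC hzp hwC hwp (Ne.symm hwz)
  obtain ⟨hsM, hxsM, hsMC⟩ := himage s hs M hM hxM z hzp hMC (hsz ▸ hwC)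
  obtain ⟨hsM', hxsM', hsM'C⟩ := himage s hs M' hM' hxM' w hwp hM'C (hsw ▸ hzC)
  rw [hsz] at hsMC
  rw [hsw] at hsM'C
  have hMM' := tangent_unique hCc hsM hM' hxC hxsM hxM' hsMC hM'C
  have hM'M := tangent_unique hCc hsM' hM hxC hxsM' hxM hsM'C hMC
  have hsy : s y = y := by
    by_contra hne
    have hyx : y ≠ x := fun e => hxy (e ▸ par_refl y)
    have hsyx : s y ≠ x := fun e =>
      hyx (s.injective (e.trans (h.fix s hs x hx).symm))
    have : M = M' := circle_eq hM hM' hne hyx hsyx (hM'M ▸ Set.mem_image_of_mem s hyM') hyM hxM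
      (hMM' ▸ Set.mem_image_of_mem s hyM) hyM' hxM'
    rw [← this, hMC] at hM'C
    exact hwz (Set.singleton_injective hM'C).symm
  have hgs : g z = s z := h.orbit_le_two hC hY hCY hyY hyp hzC hzp hyz hg hs hgy hsy hgC
    (hsz ▸ hwC) hgz (hsz ▸ hwz)
  right
  rw [hgs, hsz] at hgMC
  exact tangent_unique hCc hM' hgM hxC hxM' hxgM hM'C hgMC

/-- If `x ≡_C y`, then some circle through `x` and `y` is tangent to `C`. -/
theorem exists_tangent_of_tangentEquiv (h : L.IsResidual p K Δ) {x y : P} {C : Set P}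
    (hC : C ∈ L.pencil p K) (hx : L.Par p x) (hxp : x ≠ p) (hyC : y ∉ C) (hxy : ¬ L.Par x y)
    (hequiv : ∀ M ∈ L.Circles, ∀ N ∈ L.Circles, x ∈ M → y ∈ N →
      (∃ z, M ∩ C = {z}) → (∃ z, N ∩ C = {z}) → (M ∩ N).Nonempty) :
    ∃ M ∈ L.Circles, x ∈ M ∧ y ∈ M ∧ ∃ z, M ∩ C = {z} := by
  have hCc := h.circle_of_pencil hC
  have hpy : ¬ L.Par p y := fun h' => hxy (hx.symm.trans h')
  obtain ⟨Y, hY, hyY⟩ := h.exists_pencil hpy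
  have hYc := h.circle_of_pencil hY
  have hCY : C ≠ Y := fun e => hyC (e ▸ hyY)
  have hYC : Y ∩ C = {p} := by
    refine Set.eq_singleton_iff_unique_mem.2 ⟨⟨h.mem_of_pencil hY, h.mem_of_pencil hC⟩, ?_⟩
    rintro q ⟨hqY, hqC⟩
    by_contra hqp
    exact hCY (h.pencil_unique hC hY hqC hqY hqp)
  have hxC : x ∉ C := fun hxC => hxp (eq_of_par_s17 hCc (h.mem_of_pencil hC) hxC hx).symm
  obtain ⟨z, hzC, hpz⟩ := exists_mem_not_par p hCc
  obtain ⟨D, hD, hxD, hDC⟩ := exists_tangent hCc hzC hxC (fun h' => hpz (hx.trans h'.symm))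
  obtain ⟨a, haD, haY⟩ := hequiv D hD Y hYc hxD hyY ⟨z, hDC⟩ ⟨p, hYC⟩
  have hap : a ≠ p := fun e => not_mem_of_par hx hxp hD hxD (e ▸ haD)
  have hyp : y ≠ p := fun e => hpy (e.symm ▸ par_refl p : L.Par p y)
  obtain ⟨t, ht, htC, hta⟩ := h.exists_map_of_pencil hx hxp hY hC (Ne.symm hCY) haY hap hyY hyp
  refine ⟨t '' D, h.image_circle ht hD, ⟨x, hxD, h.fix t ht x hx⟩, ⟨a, haD, hta⟩, t z, ?_⟩
  have := image_inter_eq (σ := t) hDC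
  rwa [htC] at this

/-- If some circle through `x` and `y` is tangent to `C`, then `x ≡_C y`. -/
theorem inter_nonempty_of_tangent (h : L.IsResidual p K Δ) {x y z : P} {C D : Set P}
    (hC : C ∈ L.pencil p K) (hx : L.Par p x) (hxp : x ≠ p) (hyC : y ∉ C)
    (hD : D ∈ L.Circles) (hxD : x ∈ D) (hyD : y ∈ D) (hDC : D ∩ C = {z}) {M N : Set P}
    (hM : M ∈ L.Circles) (hN : N ∈ L.Circles) (hxM : x ∈ M) (hyN : y ∈ N) {w k : P}
    (hMC : M ∩ C = {w}) (hNC : N ∩ C = {k}) : (M ∩ N).Nonempty := by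
  have hCc := h.circle_of_pencil hC
  have hxC : x ∉ C := fun hxC => hxp (eq_of_par_s17 hCc (h.mem_of_pencil hC) hxC hx).symm
  have hzC := right_mem_of_inter_eq hDC
  have hwC := right_mem_of_inter_eq hMC
  have hkC := right_mem_of_inter_eq hNC
  have hzp : z ≠ p := fun e => not_mem_of_par hx hxp hD hxD (e ▸ left_mem_of_inter_eq hDC)
  have hwp : w ≠ p := fun e => not_mem_of_par hx hxp hM hxM (e ▸ left_mem_of_inter_eq hMC)
  have hmap : ∀ t ∈ Δ, t z = w → t '' N = N → (M ∩ N).Nonempty := by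
    intro t ht htz htN
    have htC := h.image_pencil ht hC hC hzC hzp (htz ▸ hwC)
    have htDC := image_inter_eq (σ := t) hDC
    rw [htC, htz] at htDC
    have := tangent_unique hCc (h.image_circle ht hD) hM hxC
      ⟨x, hxD, h.fix t ht x hx⟩ hxM htDC hMC
    exact ⟨t y, this ▸ Set.mem_image_of_mem t hyD, htN ▸ Set.mem_image_of_mem t hyN⟩
  by_cases hkp : k = p
  · subst hkp
    have hN' : N ∈ L.pencil k K := by
      have hky : ¬ L.Par k y := fun h' =>
        hyC (eq_of_par_s17 hN (left_mem_of_inter_eq hNC) hyN h' ▸ hkC)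
      obtain ⟨Y, hY, hyY⟩ := h.exists_pencil hky
      have hYC : Y ∩ C = {k} := by
        refine Set.eq_singleton_iff_unique_mem.2 ⟨⟨h.mem_of_pencil hY, hkC⟩, ?_⟩
        rintro q ⟨hqY, hqC⟩
        by_contra hqk
        exact hyC (h.pencil_unique hY hC hqY hqC hqk ▸ hyY)
      exact tangent_unique hCc (h.circle_of_pencil hY) hN hyC hyY hyN hYC hNC ▸ hY
    obtain ⟨t, ht, htN, htz⟩ := h.exists_map_of_pencil hx hxp hC hN'
      (fun e => hyC (e ▸ hyN)) hzC hzp hwC hwp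
    exact hmap t ht htz htN
  by_cases hwk : w = k
  · subst hwk
    exact ⟨w, left_mem_of_inter_eq hMC, left_mem_of_inter_eq hNC⟩
  by_cases hzk : z = k
  · subst hzk
    have := tangent_unique hCc hD hN hyC hyD hyN hDC hNC
    exact ⟨x, hxM, this ▸ hxD⟩
  obtain ⟨t, ht, htk, htz⟩ := h.exists_fix_map hC hkC hkp hzC hzp hzk hwC hwp hwk
  exact hmap t ht htz (h.image_tangent ht hC hN hkp hNC htk)

end IsResidual
end LaguerrePlane

/-- assume (A3).  For C ∈ ⟨p,K⟩, a point x parallel to p with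
x ≠ p and a point y ∉ C not parallel to x:  x ≡_C y iff there are exactly two
circles tangent to C through x and y. -/
theorem equiv_iff_two_tangent_circles
    {P : Type*} (L : LaguerrePlane P) (p : P) (K : Set P)
    (Δ : Subgroup (Equiv.Perm P))
    (hK : K ∈ L.Circles) (hpK : p ∈ K)
    (haut : ∀ σ ∈ Δ, L.IsAut σ)
    (hfix : ∀ σ ∈ Δ, ∀ q, L.Par p q → σ q = q)
    (hpen : ∀ σ ∈ Δ, ∀ M ∈ L.pencil p K, ⇑σ '' M ∈ L.pencil p K)
    (hA1 : ∀ x y : P, ¬ L.Par p x → ¬ L.Par p y → ∃ σ ∈ Δ, σ x = y)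
    (hA2 : ∀ r ∈ K, r ≠ p → ∀ x ∈ K, x ≠ p → x ≠ r → ∀ y ∈ K, y ≠ p → y ≠ r →
      ∃ σ ∈ Δ, σ r = r ∧ σ x = y)    (hA3 : ∀ M ∈ L.Circles, p ∉ M → ∃! N, N ∈ L.pencil p K ∧ ∃ z, M ∩ N = {z})    :
    ∀ C ∈ L.pencil p K, ∀ x y : P, L.Par p x → x ≠ p → y ∉ C → ¬ L.Par x y →
    (tangentEquiv L C x y ↔
      ∃ M N : Set P, M ≠ N ∧
        (M ∈ L.Circles ∧ x ∈ M ∧ y ∈ M ∧ ∃ z, M ∩ C = {z}) ∧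
        (N ∈ L.Circles ∧ x ∈ N ∧ y ∈ N ∧ ∃ z, N ∩ C = {z}) ∧
        (∀ M' : Set P,
          (M' ∈ L.Circles ∧ x ∈ M' ∧ y ∈ M' ∧ ∃ z, M' ∩ C = {z}) →
          M' = M ∨ M' = N)) := by
  intro C hC x y hx hxp hyC hxy
  have h : L.IsResidual p K Δ := ⟨hK, hpK, haut, hfix, hpen, hA1, hA2, hA3⟩
  constructor
  · intro hequiv
    obtain ⟨M, hM, hxM, hyM, z, hMC⟩ :=
      h.exists_tangent_of_tangentEquiv hC hx hxp hyC hxy hequiv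
    exact h.exists_two_tangent hC hx hxp hyC hxy hM hxM hyM hMC
  · rintro ⟨D, -, -, ⟨hD, hxD, hyD, z, hDC⟩, -, -⟩ M hM N hN hxM hyN ⟨w, hMC⟩ ⟨k, hNC⟩
    exact h.inter_nonempty_of_tangent hC hx hxp hyC hD hxD hyD hDC hM hN hxM hyN hMC hNC
end
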